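/- Let f : (0,∞) → ℂ be continuous and let c₀, c ∈ ℂ, C > 0, a > 0 be constants such that |f(t) − c₀| ≤ C e^{−at} for all t ≥ 1 and |f(t) − c·t^{−1/2}| ≤ C e^{−a/t} for all 0 < t ≤ 1. Set f₀(t) = f(t) − c₀·1_{[1,∞)}(t) − c·t^{−1/2}·1_{(0,1]}(t). Then: (i) I(s) = ∫₀^∞ f₀(t) t^{s−1} dt converges absolutely for every s ∈ ℂ and defines an entire function; (ii) for every s with Re(s) > 1/2, I(s) = ∫₀^∞ (f(t) − c₀) t^{s−1} dt + c₀/s − c/(s − 1/2), the integral converging absolutely; (iii) for every s with Re(s) < 0, I(s) = ∫₀^∞ (f(t) − c·t^{−1/2}) t^{s−1} dt + c₀/s − c/(s − 1/2), the integral converging absolutely. -/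

import Mathlib

open MeasureTheory

open scoped Topology
open Filter (atTop eventually_gt_atTop)

theorem MeasureTheory.LocallyIntegrableOn.indicator {X E : Type*} [MeasurableSpace X]
    [TopologicalSpace X] [NormedAddCommGroup E] {f : X → E} {s t : Set X} {μ : Measure X}
    (hf : LocallyIntegrableOn f s μ) (ht : MeasurableSet t) :
    LocallyIntegrableOn (t.indicator f) s μ := fun x hx =>
  let ⟨u, hu, hfu⟩ := hf x hx
  ⟨u, hu, hfu.indicator ht⟩

theorem isBigO_exp_neg_div_rpow_nhdsGT_zero {a : ℝ} (ha : 0 < a) (b : ℝ) :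
    (fun t : ℝ => Real.exp (-a / t)) =O[𝓝[>] 0] (fun t : ℝ => t ^ b) := by
  refine ((isLittleO_exp_neg_mul_rpow_atTop ha (-b)).isBigO.comp_tendsto
    tendsto_inv_nhdsGT_zero).congr' (.of_forall fun t => ?_) ?_
  · simp [div_eq_mul_inv]
  · filter_upwards [self_mem_nhdsWithin] with t ht
    simp [Real.inv_rpow (le_of_lt ht), Real.rpow_neg (le_of_lt ht)]

theorem HasMellin.congr_ae {E : Type*} [NormedAddCommGroup E] [NormedSpace ℂ E] {f g : ℝ → E}
    {s : ℂ} {m : E} (hf : HasMellin f s m) (h : f =ᵐ[volume.restrict (Set.Ioi 0)] g) :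
    HasMellin g s m := by
  have h' : (fun t : ℝ => (t : ℂ) ^ (s - 1) • f t) =ᵐ[volume.restrict (Set.Ioi 0)]
      fun t : ℝ => (t : ℂ) ^ (s - 1) • g t := h.mono fun t ht => by simp only [ht]
  exact ⟨Integrable.congr hf.1 h', (integral_congr_ae h').symm.trans hf.2⟩

theorem hasMellin_iff_mul {f : ℝ → ℂ} {s m : ℂ} :
    HasMellin f s m ↔ IntegrableOn (fun t : ℝ => f t * (t : ℂ) ^ (s - 1)) (Set.Ioi 0) ∧
      ∫ t in Set.Ioi (0 : ℝ), f t * (t : ℂ) ^ (s - 1) = m := by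
  simp only [HasMellin, MellinConvergent, mellin, smul_eq_mul, mul_comm]

/-- The Mellin transform of a power function restricted to `Ioi 1`. -/
theorem hasMellin_cpow_Ioi_one (a : ℂ) {s : ℂ} (hs : s.re + a.re < 0) :
    HasMellin (Set.indicator (Set.Ioi 1) (fun t : ℝ => (t : ℂ) ^ a)) s (-1 / (s + a)) := by
  have hre : (s + a - 1).re < -1 := by
    simp only [Complex.sub_re, Complex.add_re, Complex.one_re]
    linarith
  have key : Set.EqOn
      (fun t : ℝ => (t : ℂ) ^ (s - 1) • Set.indicator (Set.Ioi 1) (fun t : ℝ => (t : ℂ) ^ a) t)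
      (Set.indicator (Set.Ioi 1) (fun t : ℝ => (t : ℂ) ^ (s + a - 1))) (Set.Ioi 0) := by
    intro t ht
    have ht0 : (t : ℂ) ≠ 0 := Complex.ofReal_ne_zero.2 (ne_of_gt ht)
    by_cases h1 : t ∈ Set.Ioi (1 : ℝ)
    · simp only [Set.indicator_of_mem h1, smul_eq_mul, ← Complex.cpow_add _ _ ht0]
      ring_nf
    · simp [Set.indicator_of_notMem h1]
  have hsub : Set.Ioi (1 : ℝ) ⊆ Set.Ioi 0 := Set.Ioi_subset_Ioi zero_le_one
  constructor
  · refine (IntegrableOn.congr_fun ?_ key.symm measurableSet_Ioi)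
    exact ((integrable_indicator_iff measurableSet_Ioi).2
      (integrableOn_Ioi_cpow_of_lt hre one_pos)).integrableOn
  · rw [mellin, setIntegral_congr_fun measurableSet_Ioi key, setIntegral_indicator measurableSet_Ioi,
      Set.inter_eq_right.2 hsub, integral_Ioi_cpow_of_lt hre one_pos]
    simp

/-- The regularised Mellin transform of a heat-type function `f` with constant term `c₀`
at infinity and leading term `c·t^{-1/2}` at `0`:
(i) the Mellin transform of `f₀ = f - c₀·1_{[1,∞)} - c·t^{-1/2}·1_{(0,1]}` converges
absolutely for all `s` and is entire;
(ii) for `Re s > 1/2` it equals `∫₀^∞ (f(t) - c₀) t^{s-1} dt + c₀/s - c/(s - 1/2)`;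
(iii) for `Re s < 0` it equals `∫₀^∞ (f(t) - c t^{-1/2}) t^{s-1} dt + c₀/s - c/(s - 1/2)`. -/
theorem mellin_regularised (f : ℝ → ℂ) (hf : ContinuousOn f (Set.Ioi (0 : ℝ)))
    (c₀ c : ℂ) (C a : ℝ) (hC : 0 < C) (ha : 0 < a)
    (hinfty : ∀ t : ℝ, 1 ≤ t → ‖f t - c₀‖ ≤ C * Real.exp (-a * t))
    (hzero : ∀ t : ℝ, 0 < t → t ≤ 1 →
      ‖f t - c * (t : ℂ) ^ (-(1 / 2 : ℂ))‖ ≤ C * Real.exp (-a / t))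
    (f₀ : ℝ → ℂ)
    (hf₀ : ∀ t : ℝ, f₀ t = f t - Set.indicator (Set.Ici (1 : ℝ)) (fun _ => c₀) t
      - Set.indicator (Set.Ioc (0 : ℝ) 1) (fun t : ℝ => c * (t : ℂ) ^ (-(1 / 2 : ℂ))) t) :
    ((∀ s : ℂ, IntegrableOn (fun t : ℝ => f₀ t * (t : ℂ) ^ (s - 1)) (Set.Ioi 0)) ∧
      Differentiable ℂ (fun s : ℂ => ∫ t in Set.Ioi (0 : ℝ), f₀ t * (t : ℂ) ^ (s - 1))) ∧
    (∀ s : ℂ, 1 / 2 < s.re →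
      IntegrableOn (fun t : ℝ => (f t - c₀) * (t : ℂ) ^ (s - 1)) (Set.Ioi 0) ∧
      (∫ t in Set.Ioi (0 : ℝ), f₀ t * (t : ℂ) ^ (s - 1))
        = (∫ t in Set.Ioi (0 : ℝ), (f t - c₀) * (t : ℂ) ^ (s - 1))
          + c₀ / s - c / (s - 1 / 2)) ∧
    (∀ s : ℂ, s.re < 0 →
      IntegrableOn (fun t : ℝ => (f t - c * (t : ℂ) ^ (-(1 / 2 : ℂ))) * (t : ℂ) ^ (s - 1))
        (Set.Ioi 0) ∧
      (∫ t in Set.Ioi (0 : ℝ), f₀ t * (t : ℂ) ^ (s - 1))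
        = (∫ t in Set.Ioi (0 : ℝ),
            (f t - c * (t : ℂ) ^ (-(1 / 2 : ℂ))) * (t : ℂ) ^ (s - 1))
          + c₀ / s - c / (s - 1 / 2)) := by
  have hpow : ContinuousOn (fun t : ℝ => c * (t : ℂ) ^ (-(1 / 2 : ℂ))) (Set.Ioi 0) := fun t ht =>
    ((Complex.continuousAt_ofReal_cpow_const _ _
      (Or.inr (ne_of_gt ht))).const_mul c).continuousWithinAt
  have hloc : LocallyIntegrableOn f₀ (Set.Ioi 0) := by
    rw [funext hf₀]
    exact ((hf.locallyIntegrableOn measurableSet_Ioi).sub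
      ((locallyIntegrableOn_const c₀).indicator measurableSet_Ici)).sub
      ((hpow.locallyIntegrableOn measurableSet_Ioi).indicator measurableSet_Ioc)
  have htop : f₀ =O[atTop] fun t => Real.exp (-a * t) := by
    refine Asymptotics.IsBigO.of_bound C ?_
    filter_upwards [eventually_gt_atTop 1] with t ht
    rw [Real.norm_of_nonneg (Real.exp_nonneg _), hf₀, Set.indicator_of_mem (Set.mem_Ici.2 ht.le),
      Set.indicator_of_notMem fun h => h.2.not_gt ht, sub_zero]
    exact hinfty t ht.le
  have hbot (b : ℝ) : f₀ =O[𝓝[>] 0] fun t : ℝ => t ^ (-b) := by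
    refine (Asymptotics.IsBigO.of_bound C ?_).trans
      (isBigO_exp_neg_div_rpow_nhdsGT_zero ha (-b))
    filter_upwards [Ioo_mem_nhdsGT (zero_lt_one' ℝ)] with t ht
    rw [Real.norm_of_nonneg (Real.exp_nonneg _), hf₀,
      Set.indicator_of_notMem (s := Set.Ici 1) (not_le_of_gt ht.2),
      Set.indicator_of_mem (Set.Ioo_subset_Ioc_self ht), sub_zero]
    exact hzero t ht.1 ht.2.le
  have hconv (s : ℂ) : MellinConvergent f₀ s :=
    mellinConvergent_of_isBigO_rpow_exp ha hloc htop (hbot (s.re - 1)) (sub_one_lt _)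
  have hdiff : Differentiable ℂ (mellin f₀) := fun s =>
    mellin_differentiableAt_of_isBigO_rpow_exp ha hloc htop (hbot (s.re - 1)) (sub_one_lt _)
  have hI (s : ℂ) := hasMellin_iff_mul.1 ⟨hconv s, rfl⟩
  have hne : ∀ᵐ t : ℝ ∂volume.restrict (Set.Ioi 0), 0 < t ∧ t ≠ 1 :=
    (ae_restrict_mem measurableSet_Ioi).and (ae_restrict_of_ae (Measure.ae_ne volume 1))
  refine ⟨⟨fun s => (hI s).1, ?_⟩, fun s hs => ?_, fun s hs => ?_⟩
  · simpa only [(hI _).2] using hdiff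
  · have h₁ := hasMellin_const_smul (hasMellin_one_Ioc (s := s) (by linarith)).1 c₀
    have h₂ := hasMellin_const_smul
      (hasMellin_cpow_Ioc (-(1 / 2)) (s := s) (by norm_num; linarith)).1 c
    have h₃ := hasMellin_sub (hconv s) h₁.1
    have h₄ := hasMellin_add h₃.1 h₂.1
    rw [h₃.2, h₁.2, h₂.2, (hasMellin_one_Ioc (s := s) (by linarith)).2,
      (hasMellin_cpow_Ioc (-(1 / 2)) (s := s) (by norm_num; linarith)).2] at h₄
    have h := hasMellin_iff_mul.1 (h₄.congr_ae (g := fun t => f t - c₀) ?_)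
    · refine ⟨h.1, ?_⟩
      rw [h.2, (hI s).2, smul_eq_mul, smul_eq_mul]
      ring
    · filter_upwards [hne] with t ⟨ht, ht1⟩
      rcases lt_or_gt_of_ne ht1 with h1 | h1
      · simp [hf₀, Set.indicator, ht, h1.le, h1.not_ge]
        ring
      · simp [hf₀, Set.indicator, h1.le, h1.not_ge]
  · have h₁ := hasMellin_const_smul (hasMellin_cpow_Ioi_one 0 (s := s) (by simpa using hs)).1 c₀
    have h₂ := hasMellin_const_smul
      (hasMellin_cpow_Ioi_one (-(1 / 2)) (s := s) (by norm_num; linarith)).1 c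
    have h₃ := hasMellin_add (hconv s) h₁.1
    have h₄ := hasMellin_sub h₃.1 h₂.1
    rw [h₃.2, h₁.2, h₂.2, (hasMellin_cpow_Ioi_one 0 (s := s) (by simpa using hs)).2,
      (hasMellin_cpow_Ioi_one (-(1 / 2)) (s := s) (by norm_num; linarith)).2] at h₄
    have h := hasMellin_iff_mul.1
      (h₄.congr_ae (g := fun t : ℝ => f t - c * (t : ℂ) ^ (-(1 / 2 : ℂ))) ?_)
    · refine ⟨h.1, ?_⟩
      rw [h.2, (hI s).2, smul_eq_mul, smul_eq_mul, add_zero]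
      ring
    · filter_upwards [hne] with t ⟨ht, ht1⟩
      rcases lt_or_gt_of_ne ht1 with h1 | h1
      · simp [hf₀, Set.indicator, ht, h1.le, h1.not_ge, h1.not_gt]
      · simp [hf₀, Set.indicator, h1, h1.le, h1.not_ge]
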